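/- The augmented poset Q̂ is pure and thin: for any q1 ≤ q2 in Q̂, a maximal chain from q1 to q2 exists and all such chains have the same length, and every interval of length 2 in Q̂ contains exactly 4 elements. Moreover, for every (w,v,u) ∈ Q, every maximal chain in Q̂ from 0̂ to (w,v,u) has length ℓ(w) + ℓ(u) − ℓ(v) + 1. -/

import Mathlib

/-!
Common definitions: Bruhat order, standard parabolic subgroups, minimal coset
representatives, the J-Bruhat (twisted) order and J-length, chains and
EL-labeling machinery, for a Coxeter system `cs : CoxeterSystem M W`.
-/

open scoped Classical

namespace TwistedTP

/-- A chain (list) realizing consecutive `r`-steps starting at `a` and ending at `b`. -/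
def IsChainFrom {α : Type*} (r : α → α → Prop) (c : List α) (a b : α) : Prop :=
  c.head? = some a ∧ c.getLast? = some b ∧ c.Chain' r

/-- The word of labels attached to the consecutive pairs of a list.
For a list `z₀ :: z₁ :: ⋯` (written from top to bottom in a descending chain),
the entries are `lab z₁ z₀, lab z₂ z₁, …`, i.e. `lab` is applied to each
covering pair `(lower, upper)`. -/
def labelWord {α Λ : Type*} (lab : α → α → Λ) : List α → List Λ
  | a :: b :: rest => lab b a :: labelWord lab (b :: rest)
  | _ => []

variable {B : Type*} {W : Type*} [Group W] {M : CoxeterMatrix B}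
variable (cs : CoxeterSystem M W)

/-- The (strong) Bruhat order on `W`: `v ≤ w` iff some reduced word for `w`
has a sublist whose product is `v`. -/
def bruhatLE (v w : W) : Prop :=
  ∃ ω : List B, cs.IsReduced ω ∧ cs.wordProd ω = w ∧
    ∃ ω' : List B, ω'.Sublist ω ∧ cs.wordProd ω' = v

def bruhatLT (v w : W) : Prop := bruhatLE cs v w ∧ v ≠ w

def bruhatCovBy (v w : W) : Prop :=
  bruhatLT cs v w ∧ ¬ ∃ z, bruhatLT cs v z ∧ bruhatLT cs z w

/-- The standard parabolic subgroup `W_J`. -/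
def parabolic (J : Set B) : Subgroup W := Subgroup.closure (cs.simple '' J)

lemma exists_minRep (J : Set B) (w : W) :
    ∃ u : W, u⁻¹ * w ∈ parabolic cs J ∧
      ∀ x : W, x⁻¹ * w ∈ parabolic cs J → cs.length u ≤ cs.length x := by
  have hne : (cs.length '' {x : W | x⁻¹ * w ∈ parabolic cs J}).Nonempty :=
    ⟨cs.length w, w, by simpa using (parabolic cs J).one_mem, rfl⟩
  obtain ⟨n, hn, hmin⟩ := Nat.lt_wfRel.wf.has_min _ hne
  obtain ⟨u, hu, rfl⟩ := hn
  refine ⟨u, hu, fun x hx => ?_⟩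
  by_contra h
  exact hmin _ ⟨x, hx, rfl⟩ (Nat.lt_of_not_le h)

/-- The minimal-length representative `w^J` of the coset `w W_J`. -/
noncomputable def minRep (J : Set B) (w : W) : W := (exists_minRep cs J w).choose

/-- The parabolic part `w_J = (w^J)⁻¹ w ∈ W_J` of `w`. -/
noncomputable def parPart (J : Set B) (w : W) : W := (minRep cs J w)⁻¹ * w

/-- The J-Bruhat (twisted) order `≤^J` on `W`:
`v ≤^J w` iff there is `u ∈ W_J` with `v^J u ≤ w^J` and `w_J ≤ u⁻¹ v_J`. -/
def twistedLE (J : Set B) (v w : W) : Prop :=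
  ∃ u ∈ parabolic cs J,
    bruhatLE cs (minRep cs J v * u) (minRep cs J w) ∧
    bruhatLE cs (parPart cs J w) (u⁻¹ * parPart cs J v)

def twistedLT (J : Set B) (v w : W) : Prop := twistedLE cs J v w ∧ v ≠ w

def twistedCovBy (J : Set B) (v w : W) : Prop :=
  twistedLT cs J v w ∧ ¬ ∃ z, twistedLT cs J v z ∧ twistedLT cs J z w

/-- The J-length `ℓ^J(w) = ℓ(w^J) - ℓ(w_J)` (an integer). -/
noncomputable def twistedLength (J : Set B) (w : W) : ℤ :=
  (cs.length (minRep cs J w) : ℤ) - (cs.length (parPart cs J w) : ℤ)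



/-- Membership in `Q`: triples `(w, v, u)` such that `w ∘_l v ≤ u`, i.e. there is
`w' ≤ w` with `w' v ≤ u`. -/
def Qmem (t : W × W × W) : Prop :=
  ∃ w' : W, bruhatLE cs w' t.1 ∧ bruhatLE cs (w' * t.2.1) t.2.2

/-- The order on `Q`: `(w',v',u') ≤_Q (w,v,u)` iff `w' ≤ w`, `v ≤ v'` and `u' ≤ u`. -/
def qqle (a b : W × W × W) : Prop :=
  bruhatLE cs a.1 b.1 ∧ bruhatLE cs b.2.1 a.2.1 ∧ bruhatLE cs a.2.2 b.2.2

def qqlt (a b : W × W × W) : Prop := qqle cs a b ∧ a ≠ b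

/-- Membership in the augmented poset `Q̂ = Q ⊔ {0̂}`; `none` is the adjoined minimum. -/
def hvalid : Option (W × W × W) → Prop
  | none => True
  | some t => Qmem cs t

/-- The order of `Q̂`. -/
def hle : Option (W × W × W) → Option (W × W × W) → Prop
  | none, _ => True
  | some _, none => False
  | some a, some b => qqle cs a b

def hlt (p q : Option (W × W × W)) : Prop := hle cs p q ∧ p ≠ q

/-- The covering relation of the poset `Q̂` (among its members). -/
def hcov (p q : Option (W × W × W)) : Prop :=
  hvalid cs p ∧ hvalid cs q ∧ hlt cs p q ∧
    ¬∃ z : Option (W × W × W), hvalid cs z ∧ hlt cs p z ∧ hlt cs z q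

section Reflections

/-- The action of a simple reflection on `W × ℤ/2` which conjugates the first component and flips
the second one exactly when the first component is the simple reflection itself. -/
noncomputable def signedConj (i : B) : Equiv.Perm (W × ZMod 2) :=
  Function.Involutive.toPerm
    (fun p => (cs.simple i * p.1 * cs.simple i, p.2 + if p.1 = cs.simple i then 1 else 0)) <| by
    rintro ⟨t, ε⟩
    have h : cs.simple i * t * cs.simple i = cs.simple i ↔ t = cs.simple i := by
      constructor
      · intro h
        have := congrArg (fun x => cs.simple i * x * cs.simple i) h
        simpa [mul_assoc] using this
      · rintro rfl
        simp
    ext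
    · simp [mul_assoc]
    · by_cases ht : t = cs.simple i
      · simp only [ht, if_true, add_assoc]
        simp [show (1 + 1 : ZMod 2) = 0 from rfl]
      · simp [h, ht]

lemma signedConj_apply (i : B) (p : W × ZMod 2) :
    signedConj cs i p =
      (cs.simple i * p.1 * cs.simple i, p.2 + if p.1 = cs.simple i then 1 else 0) := rfl

lemma signedConj_mul_pow_apply (i j : B) (n : ℕ) (t : W) (ε : ZMod 2) :
    ((signedConj cs i * signedConj cs j) ^ n) (t, ε) =
      ((cs.simple i * cs.simple j) ^ n * t * ((cs.simple i * cs.simple j) ^ n)⁻¹,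
        ε + ∑ k ∈ Finset.range (2 * n),
          if t = cs.simple j * (cs.simple i * cs.simple j) ^ k then 1 else 0) := by
  set a := cs.simple i with ha
  set b := cs.simple j with hb
  have haa : a * a = 1 := cs.simple_mul_simple_self i
  have hbb : b * b = 1 := cs.simple_mul_simple_self j
  have ha' : a⁻¹ = a := cs.inv_simple i
  have hb' : b⁻¹ = b := cs.inv_simple j
  have hconj : ∀ k : ℕ, b * (a * b) ^ k = ((a * b) ^ k)⁻¹ * b := by
    intro k
    have : b * (a * b) ^ k * b⁻¹ = ((a * b) ^ k)⁻¹ := by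
      rw [← conj_pow, ← inv_pow, mul_inv_rev, ha', hb', mul_assoc b, mul_assoc a, hbb, mul_one]
    rw [← this, inv_mul_cancel_right]
  induction n with
  | zero => simp
  | succ n ih =>
    rw [pow_succ', Equiv.Perm.mul_apply, ih, Equiv.Perm.mul_apply, signedConj_apply,
      signedConj_apply, ← ha, ← hb, show 2 * (n + 1) = 2 * n + 1 + 1 by ring,
      Finset.sum_range_succ, Finset.sum_range_succ]
    set c := (a * b) ^ n with hc
    have e₁ : b * (a * b) ^ (2 * n) = c⁻¹ * b * c := by
      rw [two_mul, pow_add, ← mul_assoc, hconj n]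
    have h₁ : c * t * c⁻¹ = b ↔ t = b * (a * b) ^ (2 * n) := by
      rw [e₁]
      constructor
      · rintro h
        simp [← h, mul_assoc]
      · rintro rfl
        simp [mul_assoc]
    have h₂ : b * (c * t * c⁻¹) * b = a ↔ t = b * (a * b) ^ (2 * n + 1) := by
      have e : b * (a * b) ^ (2 * n + 1) = c⁻¹ * (b * a * b) * c := by
        rw [show 2 * n + 1 = n + (1 + n) by ring, pow_add, ← mul_assoc, hconj n, ← hc, pow_add,
          pow_one, ← hc]
        simp only [mul_assoc]
      rw [e]
      constructor
      · intro h
        rw [← h]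
        simp only [mul_assoc, hbb, mul_one]
        simp only [← mul_assoc, hbb]
        simp [mul_assoc]
      · rintro rfl
        simp [mul_assoc, ← mul_assoc b b, hbb]
    ext
    · simp only [pow_succ', ← hc, mul_inv_rev, ha', hb']
      simp only [mul_assoc]
    · simp only [h₁, h₂, add_assoc]

lemma signedConj_isLiftable : M.IsLiftable (signedConj cs) := by
  intro i j
  ext1 ⟨t, ε⟩
  rw [signedConj_mul_pow_apply, cs.simple_mul_simple_pow, two_mul, Finset.sum_range_add]
  simp only [pow_add, cs.simple_mul_simple_pow, one_mul, CharTwo.add_self_eq_zero]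
  simp

/-- The action of `W` on `W × ℤ/2` extending `signedConj`. -/
noncomputable def signedConjHom : W →* Equiv.Perm (W × ZMod 2) :=
  cs.lift ⟨signedConj cs, signedConj_isLiftable cs⟩

/-- The parity of the number of occurrences of `t` in the left inversion sequence of a word
for `w`. -/
noncomputable def invParity (w t : W) : ZMod 2 := (signedConjHom cs w⁻¹ (t, 0)).2

lemma signedConjHom_simple (i : B) : signedConjHom cs (cs.simple i) = signedConj cs i :=
  cs.lift_apply_simple (signedConj_isLiftable cs) i

lemma signedConjHom_apply (w t : W) (ε : ZMod 2) :
    signedConjHom cs w (t, ε) = (w * t * w⁻¹, ε + (signedConjHom cs w (t, 0)).2) := by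
  induction w using cs.simple_induction_left generalizing t ε with
  | one => simp
  | mul_simple_left w i ih =>
    rw [map_mul, Equiv.Perm.mul_apply, Equiv.Perm.mul_apply, ih, ih t 0, signedConjHom_simple,
      signedConj_apply, signedConj_apply]
    simp [mul_assoc, add_assoc]

lemma signedConjHom_inv_apply (w t : W) (ε : ZMod 2) :
    signedConjHom cs w⁻¹ (t, ε) = (w⁻¹ * t * w, ε + invParity cs w t) := by
  rw [signedConjHom_apply, inv_inv, invParity]

lemma invParity_one (t : W) : invParity cs 1 t = 0 := by
  simp [invParity]

lemma invParity_mul (x y t : W) :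
    invParity cs (x * y) t = invParity cs x t + invParity cs y (x⁻¹ * t * x) := by
  rw [invParity, mul_inv_rev, map_mul, Equiv.Perm.mul_apply, signedConjHom_inv_apply,
    signedConjHom_inv_apply, zero_add]

lemma invParity_simple (i : B) (t : W) :
    invParity cs (cs.simple i) t = if t = cs.simple i then 1 else 0 := by
  rw [invParity, cs.inv_simple, signedConjHom_simple, signedConj_apply]
  simp

lemma mem_leftInvSeq_of_invParity_ne_zero (ω : List B) (t : W)
    (h : invParity cs (cs.wordProd ω) t ≠ 0) : t ∈ cs.leftInvSeq ω := by
  induction ω generalizing t with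
  | nil => simp [invParity_one] at h
  | cons i ω ih =>
    rw [cs.wordProd_cons, invParity_mul, invParity_simple] at h
    rw [CoxeterSystem.leftInvSeq, List.mem_cons]
    by_cases ht : t = cs.simple i
    · exact Or.inl ht
    · rw [if_neg ht, zero_add] at h
      refine Or.inr (List.mem_map.2 ⟨_, ih _ h, ?_⟩)
      simp [mul_assoc]

lemma length_mul_lt_of_invParity_ne_zero (w t : W) (h : invParity cs w t ≠ 0) :
    cs.length (t * w) < cs.length w := by
  obtain ⟨ω, hω, rfl⟩ := cs.exists_isReduced w
  exact (cs.isLeftInversion_of_mem_leftInvSeq hω (mem_leftInvSeq_of_invParity_ne_zero cs ω t h)).2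

variable {cs} in
lemma invParity_self {t : W} (ht : cs.IsReflection t) : invParity cs t t = 1 := by
  obtain ⟨x, i, rfl⟩ := ht
  have h₁ := invParity_mul cs x x⁻¹ (x * cs.simple i * x⁻¹)
  have h₂ : x⁻¹ * (x * cs.simple i * x⁻¹) * x = cs.simple i := by simp [mul_assoc]
  rw [mul_inv_cancel, invParity_one, h₂] at h₁
  rw [invParity_mul, invParity_mul, h₂, invParity_simple, if_pos rfl, mul_inv_rev]
  have h₃ : (cs.simple i)⁻¹ * x⁻¹ * (x * cs.simple i * x⁻¹) * (x * cs.simple i) = cs.simple i := by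
    simp [mul_assoc]
  rw [h₃, add_right_comm, ← h₁, zero_add]

variable {cs} in
/-- `t` is a left inversion of `w` iff it has odd `invParity`; this contains the strong exchange
property. -/
lemma length_mul_lt_iff_invParity {t : W} (ht : cs.IsReflection t) (w : W) :
    cs.length (t * w) < cs.length w ↔ invParity cs w t = 1 := by
  constructor
  · intro h
    by_contra h'
    have h₀ : invParity cs w t = 0 := by
      revert h'
      generalize invParity cs w t = a
      revert a
      decide
    have := length_mul_lt_of_invParity_ne_zero cs (t * w) t (by
      rw [invParity_mul, invParity_self ht, inv_mul_cancel, one_mul, h₀]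
      decide)
    rw [← mul_assoc, ht.mul_self, one_mul] at this
    exact lt_asymm h this
  · intro h
    exact length_mul_lt_of_invParity_ne_zero cs w t (by rw [h]; decide)

variable {cs} in
/-- The cocycle property of left inversions: `N(x y) = N(x) ∆ x N(y) x⁻¹`. -/
lemma length_mul_mul_lt_iff {t : W} (ht : cs.IsReflection t) (x y : W) :
    cs.length (t * (x * y)) < cs.length (x * y) ↔
      ¬ (cs.length (t * x) < cs.length x ↔
        cs.length (x⁻¹ * t * x * y) < cs.length y) := by
  have ht' : cs.IsReflection (x⁻¹ * t * x) := by simpa using ht.conj x⁻¹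
  rw [length_mul_lt_iff_invParity ht, length_mul_lt_iff_invParity ht,
    length_mul_lt_iff_invParity ht', invParity_mul]
  generalize invParity cs x t = a
  generalize invParity cs y _ = b
  revert a b
  decide

end Reflections

section Bruhat

/-- `v = t w` for a reflection `t`, with `ℓ v < ℓ w`. -/
def reflectionLT (v w : W) : Prop :=
  ∃ t, cs.IsReflection t ∧ v = t * w ∧ cs.length v < cs.length w

variable {cs}

lemma reflectionLT_simple_mul {v w : W} (h : reflectionLT cs v w) (i : B) :
    reflectionLT cs (cs.simple i * v) (cs.simple i * w) ∨ w = cs.simple i * v := by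
  obtain ⟨t, ht, rfl, hlt⟩ := h
  by_cases hti : t = cs.simple i
  · right
    simp [hti]
  · left
    have ht' : cs.IsReflection (cs.simple i * t * cs.simple i) := by
      simpa using ht.conj (cs.simple i)
    have hconj : cs.simple i * t * cs.simple i * (cs.simple i * w) = cs.simple i * (t * w) := by
      simp [mul_assoc]
    refine ⟨cs.simple i * t * cs.simple i, ht', hconj.symm, ?_⟩
    rw [← hconj, length_mul_lt_iff_invParity ht', invParity_mul, invParity_simple, if_neg, zero_add,
      ← length_mul_lt_iff_invParity]
    · simpa [mul_assoc] using hlt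
    · simpa [mul_assoc] using ht
    · intro h
      apply hti
      have := congrArg (fun x => cs.simple i * x * cs.simple i) h
      simpa [mul_assoc] using this

lemma reflectionLT_simple {w : W} {i : B} (h : cs.length w < cs.length (cs.simple i * w)) :
    reflectionLT cs w (cs.simple i * w) :=
  ⟨cs.simple i, cs.isReflection_simple i, by simp, h⟩

open Relation in
lemma reflTransGen_simple_mul {v w : W} (h : ReflTransGen (reflectionLT cs) v w) (i : B) :
    ReflTransGen (reflectionLT cs) (cs.simple i * v) (cs.simple i * w) ∨
      (ReflTransGen (reflectionLT cs) (cs.simple i * v) w ∧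
        ReflTransGen (reflectionLT cs) v (cs.simple i * w)) := by
  induction h with
  | refl => exact Or.inl .refl
  | @tail b w hvb hbw ih =>
    rcases reflectionLT_simple_mul hbw i with h | rfl
    · rcases ih with h₁ | ⟨h₁, h₂⟩
      · exact Or.inl (h₁.tail h)
      · exact Or.inr ⟨h₁.tail hbw, h₂.tail h⟩
    · rw [cs.simple_mul_simple_cancel_left]
      rcases ih with h₁ | ⟨h₁, h₂⟩
      · exact Or.inr ⟨h₁, hvb⟩
      · exact Or.inr ⟨h₁.tail hbw, hvb⟩

lemma length_wordProd_lt_of_isReduced_cons {i : B} {ω : List B} (h : cs.IsReduced (i :: ω)) :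
    cs.IsReduced ω ∧ cs.length (cs.wordProd ω) < cs.length (cs.simple i * cs.wordProd ω) := by
  have hω : cs.IsReduced ω := by simpa using h.drop 1
  refine ⟨hω, ?_⟩
  rw [← cs.wordProd_cons, h.eq, hω.eq, List.length_cons]
  exact Nat.lt_succ_self _

open Relation in
lemma reflTransGen_of_sublist {ω' ω : List B} (h : ω'.Sublist ω) (hω : cs.IsReduced ω) :
    ReflTransGen (reflectionLT cs) (cs.wordProd ω') (cs.wordProd ω) := by
  induction h with
  | slnil => exact .refl
  | cons i _ ih =>
    obtain ⟨hω', hlt⟩ := length_wordProd_lt_of_isReduced_cons hω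
    rw [cs.wordProd_cons]
    exact (ih hω').tail (reflectionLT_simple hlt)
  | cons_cons i _ ih =>
    obtain ⟨hω', hlt⟩ := length_wordProd_lt_of_isReduced_cons hω
    rw [cs.wordProd_cons, cs.wordProd_cons]
    rcases reflTransGen_simple_mul (ih hω') i with h | h
    · exact h
    · exact h.1.tail (reflectionLT_simple hlt)

open Relation in
lemma exists_sublist_of_reflTransGen {v : W} {ω : List B} (hω : cs.IsReduced ω)
    (h : ReflTransGen (reflectionLT cs) v (cs.wordProd ω)) :
    ∃ ω' : List B, ω'.Sublist ω ∧ cs.wordProd ω' = v := by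
  induction ω generalizing v with
  | nil =>
    rcases h.cases_tail with h | ⟨_, _, _, _, _, h⟩
    · exact ⟨[], .refl _, h⟩
    · simp at h
  | cons i ω ih =>
    obtain ⟨hω', hlt⟩ := length_wordProd_lt_of_isReduced_cons hω
    rw [cs.wordProd_cons] at h
    have hZ := reflTransGen_simple_mul h i
    rw [cs.simple_mul_simple_cancel_left] at hZ
    by_cases hv : cs.length v < cs.length (cs.simple i * v)
    · obtain ⟨ω', hs, rfl⟩ := ih hω'
        (hZ.elim (fun h' => h'.head (reflectionLT_simple hv)) And.right)
      exact ⟨ω', hs.cons i, rfl⟩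
    · have hv' : reflectionLT cs (cs.simple i * v) v :=
        ⟨cs.simple i, cs.isReflection_simple i, rfl,
          (cs.length_simple_mul_ne v i).lt_of_le (not_lt.1 hv)⟩
      obtain ⟨ω', hs, hprod⟩ := ih hω' (hZ.elim id fun h' => h'.2.head hv')
      exact ⟨i :: ω', hs.cons_cons i, by simp [cs.wordProd_cons, hprod]⟩

/-- The Bruhat order is generated by length-increasing multiplications by reflections. -/
lemma bruhatLE_iff_reflTransGen {v w : W} :
    bruhatLE cs v w ↔ Relation.ReflTransGen (reflectionLT cs) v w := by
  constructor
  · rintro ⟨ω, hω, rfl, ω', h, rfl⟩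
    exact reflTransGen_of_sublist h hω
  · intro h
    obtain ⟨ω, hω, rfl⟩ := cs.exists_isReduced w
    exact ⟨ω, hω, rfl, exists_sublist_of_reflTransGen hω h⟩

variable (cs) in
lemma bruhatLE_refl (w : W) : bruhatLE cs w w := bruhatLE_iff_reflTransGen.2 .refl

lemma bruhatLE_trans {u v w : W} (h : bruhatLE cs u v) (h' : bruhatLE cs v w) :
    bruhatLE cs u w := by
  rw [bruhatLE_iff_reflTransGen] at *
  exact h.trans h'

lemma bruhatLE_of_reflection {t w : W} (ht : cs.IsReflection t)
    (h : cs.length (t * w) < cs.length w) : bruhatLE cs (t * w) w :=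
  bruhatLE_iff_reflTransGen.2 (.single ⟨t, ht, rfl, h⟩)

lemma bruhatLE_simple {w : W} {i : B} (h : cs.length w < cs.length (cs.simple i * w)) :
    bruhatLE cs w (cs.simple i * w) :=
  bruhatLE_iff_reflTransGen.2 (.single (reflectionLT_simple h))

lemma simple_mul_bruhatLE {w : W} {i : B} (h : cs.length (cs.simple i * w) < cs.length w) :
    bruhatLE cs (cs.simple i * w) w :=
  bruhatLE_of_reflection (cs.isReflection_simple i) h

/-- The lifting property, without assumptions on descents. -/
lemma bruhatLE_simple_mul {v w : W} (h : bruhatLE cs v w) (i : B) :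
    bruhatLE cs (cs.simple i * v) (cs.simple i * w) ∨
      (bruhatLE cs (cs.simple i * v) w ∧ bruhatLE cs v (cs.simple i * w)) := by
  simp only [bruhatLE_iff_reflTransGen] at *
  exact reflTransGen_simple_mul h i

lemma bruhatLE_eq_or_length_lt {v w : W} (h : bruhatLE cs v w) :
    v = w ∨ cs.length v < cs.length w := by
  rw [bruhatLE_iff_reflTransGen] at h
  induction h with
  | refl => exact Or.inl rfl
  | tail _ h ih =>
    obtain ⟨_, _, _, h⟩ := h
    rcases ih with rfl | ih
    · exact Or.inr h
    · exact Or.inr (ih.trans h)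

lemma exists_reflection_of_bruhatLE {v w : W} (h : bruhatLE cs v w)
    (hl : cs.length w = cs.length v + 1) : ∃ t, cs.IsReflection t ∧ v = t * w := by
  have h' := bruhatLE_iff_reflTransGen.1 h
  rcases h'.cases_tail with rfl | ⟨b, hvb, hbw⟩
  · omega
  · have hb := bruhatLE_eq_or_length_lt (bruhatLE_iff_reflTransGen.2 hvb)
    obtain ⟨t, ht, rfl, hlt⟩ := hbw
    rcases hb with rfl | hb
    · exact ⟨t, ht, rfl⟩
    · omega

lemma bruhatLE_simple_mul_of_lt {v w : W} (h : bruhatLE cs v w) {i : B}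
    (hw : cs.length w < cs.length (cs.simple i * w)) :
    bruhatLE cs (cs.simple i * v) (cs.simple i * w) := by
  rcases bruhatLE_simple_mul h i with h | h
  · exact h
  · exact bruhatLE_trans h.1 (bruhatLE_simple hw)

lemma bruhatLE_simple_mul_of_gt {v w : W} (h : bruhatLE cs v w) {i : B}
    (hv : cs.length (cs.simple i * v) < cs.length v) :
    bruhatLE cs (cs.simple i * v) (cs.simple i * w) := by
  rcases bruhatLE_simple_mul h i with h | h
  · exact h
  · exact bruhatLE_trans (simple_mul_bruhatLE hv) h.2

lemma bruhatLE_simple_mul_right {v w : W} (h : bruhatLE cs v w) {i : B}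
    (hv : cs.length v < cs.length (cs.simple i * v)) :
    bruhatLE cs v (cs.simple i * w) := by
  rcases bruhatLE_simple_mul h i with h | h
  · exact bruhatLE_trans (bruhatLE_simple hv) h
  · exact h.2

lemma bruhatLE_simple_mul_left {v w : W} (h : bruhatLE cs v w) {i : B}
    (hw : cs.length (cs.simple i * w) < cs.length w) :
    bruhatLE cs (cs.simple i * v) w := by
  rcases bruhatLE_simple_mul h i with h | h
  · exact bruhatLE_trans h (simple_mul_bruhatLE hw)
  · exact h.1

/-- Every Bruhat interval starts with a step of length one. -/
lemma exists_bruhatLE_length_eq_add_one {v w : W} (h : bruhatLE cs v w) (hne : v ≠ w) :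
    ∃ z, bruhatLE cs v z ∧ bruhatLE cs z w ∧ cs.length z = cs.length v + 1 := by
  induction hn : cs.length w using Nat.strong_induction_on generalizing v w with
  | _ n ih =>
  have hlt := (bruhatLE_eq_or_length_lt h).resolve_left hne
  have hw1 : w ≠ 1 := by
    rintro rfl
    simp at hlt
  obtain ⟨i, hi⟩ := cs.exists_leftDescent_of_ne_one hw1
  rw [CoxeterSystem.IsLeftDescent] at hi
  have hsw : bruhatLE cs (cs.simple i * w) w := simple_mul_bruhatLE hi
  by_cases hv : cs.length v < cs.length (cs.simple i * v)
  · have hv' := bruhatLE_simple_mul_right h hv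
    by_cases hvw : v = cs.simple i * w
    · refine ⟨w, h, bruhatLE_refl cs w, ?_⟩
      have := cs.isLeftDescent_iff.1 hi
      rw [← hvw] at this
      omega
    · obtain ⟨z, h₁, h₂, h₃⟩ := ih _ (hn ▸ hi) hv' hvw rfl
      exact ⟨z, h₁, bruhatLE_trans h₂ hsw, h₃⟩
  · have hv₁ := cs.length_simple_mul v i
    have hv₂ : cs.length (cs.simple i * v) < cs.length v := by omega
    have hv' := bruhatLE_simple_mul_of_gt h hv₂
    obtain ⟨z, h₁, h₂, h₃⟩ := ih _ (hn ▸ hi) hv' (by simpa using hne) rfl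
    have hz := cs.length_simple_mul z i
    by_cases hz' : cs.length z < cs.length (cs.simple i * z)
    · refine ⟨cs.simple i * z, ?_, ?_, by omega⟩
      · simpa using bruhatLE_simple_mul_of_lt h₁ hz'
      · simpa using bruhatLE_simple_mul_left (bruhatLE_trans h₂ hsw) hi
    · have h₄ := bruhatLE_simple_mul_right h₁ (i := i) (by simpa using hv₂)
      have h₅ : cs.simple i * v = cs.simple i * z :=
        (bruhatLE_eq_or_length_lt h₄).resolve_right (by omega)
      rw [mul_right_inj] at h₅
      subst h₅
      obtain ⟨y, h₆, h₇, h₈⟩ := ih _ (hn ▸ hi) h₂ (by rintro rfl; simp at hv₂; omega) rfl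
      exact ⟨y, h₆, bruhatLE_trans h₇ hsw, h₈⟩

/-- Bruhat intervals of length two have exactly two intermediate elements. -/
lemma exists_two_between_bruhat {v w : W} (h : bruhatLE cs v w)
    (hl : cs.length w = cs.length v + 2) :
    ∃ p q, p ≠ q ∧ ∀ z, (bruhatLE cs v z ∧ bruhatLE cs z w ∧ cs.length z = cs.length v + 1) ↔
      z = p ∨ z = q := by
  induction hn : cs.length w using Nat.strong_induction_on generalizing v w with
  | _ n ih =>
  have hw1 : w ≠ 1 := by
    rintro rfl
    simp at hl
  obtain ⟨i, hi⟩ := cs.exists_leftDescent_of_ne_one hw1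
  have hi' := cs.isLeftDescent_iff.1 hi
  rw [CoxeterSystem.IsLeftDescent] at hi
  have hsw : bruhatLE cs (cs.simple i * w) w := simple_mul_bruhatLE hi
  rcases cs.length_simple_mul v i with hv | hv
  · refine ⟨cs.simple i * w, cs.simple i * v, ?_, fun z => ⟨?_, ?_⟩⟩
    · rw [Ne, mul_right_inj]
      rintro rfl
      omega
    · rintro ⟨h₁, h₂, h₃⟩
      rcases cs.length_simple_mul z i with hz | hz
      · left
        exact (bruhatLE_eq_or_length_lt (bruhatLE_simple_mul_right h₂ (i := i)
          (by omega))).resolve_right (by omega)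
      · right
        have := (bruhatLE_eq_or_length_lt (bruhatLE_simple_mul_right h₁ (i := i)
          (by omega))).resolve_right (by omega)
        simp [this]
    · rintro (rfl | rfl)
      · exact ⟨bruhatLE_simple_mul_right h (by omega), hsw, by omega⟩
      · exact ⟨bruhatLE_simple (by omega), bruhatLE_simple_mul_left h hi, by omega⟩
  · obtain ⟨p, q, hpq, hz⟩ := ih _ (hn ▸ hi)
      (bruhatLE_simple_mul_of_gt h (i := i) (by omega)) (by omega) rfl
    have hvv : bruhatLE cs (cs.simple i * v) v := simple_mul_bruhatLE (by omega)
    -- multiplication by the simple reflection, except that `v` goes to the left coatom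
    let f : W → W := fun z => if z = v then cs.simple i * w else cs.simple i * z
    have key : ∀ z, (bruhatLE cs v z ∧ bruhatLE cs z w ∧ cs.length z = cs.length v + 1) ↔
        ∃ y, (bruhatLE cs (cs.simple i * v) y ∧ bruhatLE cs y (cs.simple i * w) ∧
          cs.length y = cs.length (cs.simple i * v) + 1) ∧ z = f y := by
      intro z
      constructor
      · rintro ⟨h₁, h₂, h₃⟩
        rcases cs.length_simple_mul z i with hz | hz
        · have : z = cs.simple i * w := (bruhatLE_eq_or_length_lt (bruhatLE_simple_mul_right h₂
            (i := i) (by omega))).resolve_right (by omega)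
          subst this
          exact ⟨v, ⟨hvv, h₁, by omega⟩, by simp [f]⟩
        · refine ⟨cs.simple i * z, ⟨bruhatLE_simple_mul_of_gt h₁ (by omega),
            bruhatLE_simple_mul_of_gt h₂ (by omega), by omega⟩, ?_⟩
          have : cs.simple i * z ≠ v := by
            rintro rfl
            simp at hv
            omega
          simp [f, this]
      · rintro ⟨y, ⟨h₁, h₂, h₃⟩, rfl⟩
        by_cases hy : y = v
        · subst hy
          simp only [f, if_true]
          exact ⟨h₂, hsw, by omega⟩
        · simp only [f, if_neg hy]
          rcases cs.length_simple_mul y i with hy' | hy'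
          · refine ⟨?_, bruhatLE_simple_mul_left (bruhatLE_trans h₂ hsw) hi, by omega⟩
            simpa using bruhatLE_simple_mul_of_lt h₁ (i := i) (by omega)
          · have := (bruhatLE_eq_or_length_lt (bruhatLE_simple_mul_right h₁ (i := i)
              (by rw [cs.simple_mul_simple_cancel_left]; omega))).resolve_right (by omega)
            rw [mul_right_inj] at this
            exact absurd this.symm hy
    have hlen : ∀ y, y = p ∨ y = q → cs.simple i * y ≠ cs.simple i * w := by
      intro y hy h'
      have := ((hz y).2 hy).2.2
      rw [mul_right_inj] at h'
      subst h'
      omega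
    refine ⟨f p, f q, ?_, fun z => ?_⟩
    · have hp := hlen p (Or.inl rfl)
      have hq := hlen q (Or.inr rfl)
      simp only [f]
      split_ifs with h₁ h₂ h₂
      · exact absurd (h₁.trans h₂.symm) hpq
      · exact hq.symm
      · exact hp
      · simpa using hpq
    · rw [key]
      simp only [hz]
      constructor
      · rintro ⟨y, rfl | rfl, rfl⟩
        · exact Or.inl rfl
        · exact Or.inr rfl
      · rintro (rfl | rfl)
        · exact ⟨p, Or.inl rfl, rfl⟩
        · exact ⟨q, Or.inr rfl, rfl⟩

end Bruhat

section GradedThin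

/-- A relation that restricts to a partial order on `S`, graded by `rk`, in which every interval
of length two has exactly two intermediate elements. -/
structure GradedThin {α : Type*} (S : Set α) (le : α → α → Prop) (rk : α → ℤ) : Prop where
  refl : ∀ a, le a a
  trans : ∀ {a b c}, le a b → le b c → le a c
  eq_or_rk_lt : ∀ {a b}, a ∈ S → b ∈ S → le a b → a = b ∨ rk a < rk b
  exists_up : ∀ {a b}, a ∈ S → b ∈ S → le a b → a ≠ b →
    ∃ z ∈ S, le a z ∧ le z b ∧ rk z = rk a + 1
  exists_two_between : ∀ {a b}, a ∈ S → b ∈ S → le a b → rk b = rk a + 2 →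
    ∃ p q, p ≠ q ∧ ∀ z, (z ∈ S ∧ le a z ∧ le z b ∧ rk z = rk a + 1) ↔ z = p ∨ z = q

namespace GradedThin

variable {α β : Type*} {S : Set α} {le : α → α → Prop} {rk : α → ℤ}
  {le' : β → β → Prop} {rk' : β → ℤ}

lemma rk_le (h : GradedThin S le rk) {a b : α} (ha : a ∈ S) (hb : b ∈ S) (hab : le a b) :
    rk a ≤ rk b := by
  rcases h.eq_or_rk_lt ha hb hab with rfl | hlt
  · exact le_rfl
  · exact hlt.le

lemma eq_of_rk_le (h : GradedThin S le rk) {a b : α} (ha : a ∈ S) (hb : b ∈ S) (hab : le a b)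
    (hr : rk b ≤ rk a) : a = b :=
  (h.eq_or_rk_lt ha hb hab).resolve_right (not_lt.2 hr)

lemma exists_down (h : GradedThin S le rk) {a b : α} (ha : a ∈ S) (hb : b ∈ S) (hab : le a b)
    (hne : a ≠ b) : ∃ z ∈ S, le a z ∧ le z b ∧ rk b = rk z + 1 := by
  induction hn : (rk b - rk a).toNat using Nat.strong_induction_on generalizing a with
  | _ n ih =>
  have hlt := (h.eq_or_rk_lt ha hb hab).resolve_left hne
  obtain ⟨z, hz, haz, hzb, hrz⟩ := h.exists_up ha hb hab hne
  by_cases hzb' : z = b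
  · subst hzb'
    exact ⟨a, ha, h.refl a, hab, hrz⟩
  · obtain ⟨y, hy, hzy, hyb, hry⟩ := ih _ (by omega) hz hzb hzb' rfl
    exact ⟨y, hy, h.trans haz hzy, hyb, hry⟩

lemma flip (h : GradedThin S le rk) : GradedThin S (fun a b => le b a) (fun a => -rk a) where
  refl := h.refl
  trans hab hbc := h.trans hbc hab
  eq_or_rk_lt ha hb hab := (h.eq_or_rk_lt hb ha hab).imp Eq.symm neg_lt_neg
  exists_up ha hb hab hne := by
    obtain ⟨z, hz, h₁, h₂, h₃⟩ := h.exists_down hb ha hab hne.symm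
    exact ⟨z, hz, h₂, h₁, by omega⟩
  exists_two_between {a b} ha hb hab hr := by
    obtain ⟨p, q, hpq, hz⟩ := h.exists_two_between hb ha hab (by omega)
    refine ⟨p, q, hpq, fun z => ?_⟩
    rw [← hz]
    constructor
    · rintro ⟨h₁, h₂, h₃, h₄⟩
      exact ⟨h₁, h₃, h₂, by omega⟩
    · rintro ⟨h₁, h₂, h₃, h₄⟩
      exact ⟨h₁, h₃, h₂, by omega⟩

lemma prod (h : GradedThin Set.univ le rk) (h' : GradedThin Set.univ le' rk') :
    GradedThin Set.univ (fun a b : α × β => le a.1 b.1 ∧ le' a.2 b.2)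
      (fun a => rk a.1 + rk' a.2) where
  refl a := ⟨h.refl _, h'.refl _⟩
  trans hab hbc := ⟨h.trans hab.1 hbc.1, h'.trans hab.2 hbc.2⟩
  eq_or_rk_lt {a b} _ _ hab := by
    have h₁ := h.eq_or_rk_lt (Set.mem_univ _) (Set.mem_univ _) hab.1
    have h₂ := h'.eq_or_rk_lt (Set.mem_univ _) (Set.mem_univ _) hab.2
    rcases h₁ with h₁ | h₁
    · rcases h₂ with h₂ | h₂
      · exact Or.inl (Prod.ext h₁ h₂)
      · right
        rw [h₁]
        omega
    · have := h'.rk_le (Set.mem_univ _) (Set.mem_univ _) hab.2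
      right
      omega
  exists_up {a b} _ _ hab hne := by
    by_cases h₁ : a.1 = b.1
    · have h₂ : a.2 ≠ b.2 := fun h₂ => hne (Prod.ext h₁ h₂)
      obtain ⟨z, -, hz₁, hz₂, hz₃⟩ :=
        h'.exists_up (Set.mem_univ _) (Set.mem_univ _) hab.2 h₂
      exact ⟨(a.1, z), Set.mem_univ _, ⟨h.refl _, hz₁⟩, ⟨hab.1, hz₂⟩, by simp only; omega⟩
    · obtain ⟨z, -, hz₁, hz₂, hz₃⟩ :=
        h.exists_up (Set.mem_univ _) (Set.mem_univ _) hab.1 h₁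
      exact ⟨(z, a.2), Set.mem_univ _, ⟨hz₁, h'.refl _⟩, ⟨hz₂, hab.2⟩, by simp only; omega⟩
  exists_two_between := by
    rintro ⟨a₁, a₂⟩ ⟨b₁, b₂⟩ - - ⟨hab₁, hab₂⟩ hr
    simp only at hab₁ hab₂ hr
    have hle₁ := h.rk_le (Set.mem_univ _) (Set.mem_univ _) hab₁
    have hle₂ := h'.rk_le (Set.mem_univ _) (Set.mem_univ _) hab₂
    have hcases : rk b₁ = rk a₁ ∨ rk b₁ = rk a₁ + 1 ∨ rk b₁ = rk a₁ + 2 := by omega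
    rcases hcases with hc | hc | hc
    · obtain rfl := h.eq_of_rk_le (Set.mem_univ _) (Set.mem_univ _) hab₁ hc.le
      obtain ⟨p, q, hpq, hz⟩ := h'.exists_two_between (Set.mem_univ _) (Set.mem_univ _) hab₂
        (by omega)
      refine ⟨(a₁, p), (a₁, q), by simpa using hpq, ?_⟩
      rintro ⟨z₁, z₂⟩
      constructor
      · rintro ⟨-, ⟨h₁, h₂⟩, ⟨h₃, h₄⟩, h₅⟩
        simp only at h₁ h₂ h₃ h₄ h₅
        have := h.rk_le (Set.mem_univ _) (Set.mem_univ _) h₁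
        obtain rfl := h.eq_of_rk_le (Set.mem_univ _) (Set.mem_univ _) h₁
          (h.rk_le (Set.mem_univ _) (Set.mem_univ _) h₃)
        simpa using (hz z₂).1 ⟨Set.mem_univ _, h₂, h₄, by omega⟩
      · intro hz'
        have hz₁ : z₁ = a₁ := by
          rcases hz' with hz' | hz' <;> exact congrArg Prod.fst hz'
        obtain ⟨-, h₁, h₂, h₃⟩ := (hz z₂).2 (by simpa [hz₁] using hz')
        subst hz₁
        exact ⟨Set.mem_univ _, ⟨hab₁, h₁⟩, ⟨hab₁, h₂⟩, by simp only; omega⟩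
    · refine ⟨(a₁, b₂), (b₁, a₂), ?_, ?_⟩
      · intro heq
        rw [show a₁ = b₁ from congrArg Prod.fst heq] at hc
        omega
      · rintro ⟨z₁, z₂⟩
        constructor
        · rintro ⟨-, ⟨h₁, h₂⟩, ⟨h₃, h₄⟩, h₅⟩
          simp only at h₁ h₂ h₃ h₄ h₅
          have hr₁ := h.rk_le (Set.mem_univ _) (Set.mem_univ _) h₁
          have hr₂ := h'.rk_le (Set.mem_univ _) (Set.mem_univ _) h₂
          have hr₃ := h.rk_le (Set.mem_univ _) (Set.mem_univ _) h₃
          by_cases hz : rk z₁ = rk a₁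
          · left
            rw [h.eq_of_rk_le (Set.mem_univ _) (Set.mem_univ _) h₁ hz.le,
              h'.eq_of_rk_le (Set.mem_univ _) (Set.mem_univ _) h₄ (by omega)]
          · right
            rw [h.eq_of_rk_le (Set.mem_univ _) (Set.mem_univ _) h₃ (by omega),
              h'.eq_of_rk_le (Set.mem_univ _) (Set.mem_univ _) h₂ (by omega)]
        · rintro (hz | hz)
          · obtain ⟨rfl, rfl⟩ := Prod.ext_iff.1 hz
            exact ⟨Set.mem_univ _, ⟨h.refl _, hab₂⟩, ⟨hab₁, h'.refl _⟩, by simp only at *; omega⟩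
          · obtain ⟨rfl, rfl⟩ := Prod.ext_iff.1 hz
            exact ⟨Set.mem_univ _, ⟨hab₁, h'.refl _⟩, ⟨h.refl _, hab₂⟩, by simp only at *; omega⟩
    · obtain rfl := h'.eq_of_rk_le (Set.mem_univ _) (Set.mem_univ _) hab₂ (by omega)
      obtain ⟨p, q, hpq, hz⟩ := h.exists_two_between (Set.mem_univ _) (Set.mem_univ _) hab₁ hc
      refine ⟨(p, a₂), (q, a₂), by simpa using hpq, ?_⟩
      rintro ⟨z₁, z₂⟩
      constructor
      · rintro ⟨-, ⟨h₁, h₂⟩, ⟨h₃, h₄⟩, h₅⟩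
        simp only at h₁ h₂ h₃ h₄ h₅
        obtain rfl := h'.eq_of_rk_le (Set.mem_univ _) (Set.mem_univ _) h₂
          (h'.rk_le (Set.mem_univ _) (Set.mem_univ _) h₄)
        simpa using (hz z₁).1 ⟨Set.mem_univ _, h₁, h₃, by omega⟩
      · intro hz'
        have hz₂ : z₂ = a₂ := by
          rcases hz' with hz' | hz' <;> exact congrArg Prod.snd hz'
        obtain ⟨-, h₁, h₂, h₃⟩ := (hz z₁).2 (by simpa [hz₂] using hz')
        subst hz₂
        exact ⟨Set.mem_univ _, ⟨h₁, hab₂⟩, ⟨h₂, hab₂⟩, by simp only; omega⟩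

/-- Covering pairs are the comparable pairs of consecutive ranks. -/
lemma cov_iff (h : GradedThin S le rk) {a b : α} :
    (a ∈ S ∧ b ∈ S ∧ (le a b ∧ a ≠ b) ∧
      ¬∃ z, z ∈ S ∧ (le a z ∧ a ≠ z) ∧ (le z b ∧ z ≠ b)) ↔
    a ∈ S ∧ b ∈ S ∧ le a b ∧ rk b = rk a + 1 := by
  constructor
  · rintro ⟨ha, hb, ⟨hab, hne⟩, hno⟩
    refine ⟨ha, hb, hab, ?_⟩
    obtain ⟨z, hz, haz, hzb, hr⟩ := h.exists_up ha hb hab hne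
    by_cases hzb' : z = b
    · rwa [← hzb']
    · refine absurd ⟨z, hz, ⟨haz, ?_⟩, hzb, hzb'⟩ hno
      rintro rfl
      omega
  · rintro ⟨ha, hb, hab, hr⟩
    refine ⟨ha, hb, ⟨hab, ?_⟩, ?_⟩
    · rintro rfl
      omega
    · rintro ⟨z, hz, ⟨haz, hne⟩, hzb, hne'⟩
      have h₁ := (h.eq_or_rk_lt ha hz haz).resolve_left hne
      have h₂ := (h.eq_or_rk_lt hz hb hzb).resolve_left hne'
      omega

lemma ncard_eq_four (h : GradedThin S le rk) {a b : α} (ha : a ∈ S) (hb : b ∈ S) (hab : le a b)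
    (hr : rk b = rk a + 2) : {z | z ∈ S ∧ le a z ∧ le z b}.ncard = 4 := by
  obtain ⟨p, q, hpq, hz⟩ := h.exists_two_between ha hb hab hr
  have hp := (hz p).2 (Or.inl rfl)
  have hq := (hz q).2 (Or.inr rfl)
  have hset : {z | z ∈ S ∧ le a z ∧ le z b} = {a, p, q, b} := by
    ext z
    simp only [Set.mem_ofPred_eq, Set.mem_insert_iff, Set.mem_singleton_iff]
    constructor
    · rintro ⟨h₁, h₂, h₃⟩
      rcases h.eq_or_rk_lt ha h₁ h₂ with rfl | h₄
      · exact Or.inl rfl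
      rcases h.eq_or_rk_lt h₁ hb h₃ with rfl | h₅
      · exact Or.inr (Or.inr (Or.inr rfl))
      · have := (hz z).1 ⟨h₁, h₂, h₃, by omega⟩
        tauto
    · rintro (rfl | rfl | rfl | rfl)
      · exact ⟨ha, h.refl _, hab⟩
      · exact ⟨hp.1, hp.2.1, hp.2.2.1⟩
      · exact ⟨hq.1, hq.2.1, hq.2.2.1⟩
      · exact ⟨hb, hab, h.refl _⟩
  have hap : a ≠ p := by rintro rfl; omega
  have haq : a ≠ q := by rintro rfl; omega
  have hne : a ≠ b := by rintro rfl; omega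
  have hpb : p ≠ b := by rintro rfl; omega
  have hqb : q ≠ b := by rintro rfl; omega
  rw [hset, Set.ncard_insert_of_notMem (by simp [hap, haq, hne]),
    Set.ncard_insert_of_notMem (by simp [hpq, hpb]), Set.ncard_pair hqb]

lemma exists_isChainFrom (h : GradedThin S le rk) {r : α → α → Prop}
    (hcov : ∀ {a b}, a ∈ S → b ∈ S → le a b → rk b = rk a + 1 → r a b)
    {a b : α} (ha : a ∈ S) (hb : b ∈ S) (hab : le a b) : ∃ c, IsChainFrom r c a b := by
  induction hn : (rk b - rk a).toNat using Nat.strong_induction_on generalizing a with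
  | _ n ih =>
  rcases h.eq_or_rk_lt ha hb hab with rfl | hlt
  · exact ⟨[a], rfl, rfl, .singleton a⟩
  · obtain ⟨z, hz, haz, hzb, hr⟩ := h.exists_up ha hb hab (by rintro rfl; omega)
    obtain ⟨c, hc₁, hc₂, hc₃⟩ := ih _ (by omega) hz hzb rfl
    cases c with
    | nil => simp at hc₁
    | cons x c =>
      obtain rfl : x = z := by simpa using hc₁
      exact ⟨a :: x :: c, rfl, by simpa using hc₂, .cons_cons (hcov ha hz haz hr) hc₃⟩

end GradedThin

lemma IsChainFrom.length_eq {α : Type*} {r : α → α → Prop} {rk : α → ℤ}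
    (hr : ∀ {a b}, r a b → rk b = rk a + 1) {c : List α} {a b : α} (h : IsChainFrom r c a b) :
    (c.length : ℤ) = rk b - rk a + 1 := by
  obtain ⟨h₁, h₂, h₃⟩ := h
  induction c generalizing a with
  | nil => simp at h₁
  | cons x c ih =>
    obtain rfl : x = a := by simpa using h₁
    cases c with
    | nil =>
      obtain rfl : x = b := by simpa using h₂
      simp
    | cons y c =>
      have h₄ := ih rfl (by simpa using h₂) h₃.tail
      have h₅ := hr h₃.rel
      rw [List.length_cons]
      push_cast at *
      omega

end GradedThin

section AugmentedPoset

lemma gradedThin_bruhatLE :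
    GradedThin Set.univ (bruhatLE cs) (fun w => (cs.length w : ℤ)) where
  refl := bruhatLE_refl cs
  trans := bruhatLE_trans
  eq_or_rk_lt _ _ h := by exact_mod_cast bruhatLE_eq_or_length_lt h
  exists_up _ _ h hne := by
    obtain ⟨z, h₁, h₂, h₃⟩ := exists_bruhatLE_length_eq_add_one h hne
    exact ⟨z, Set.mem_univ _, h₁, h₂, by exact_mod_cast h₃⟩
  exists_two_between _ _ h hl := by
    obtain ⟨p, q, hpq, hz⟩ := exists_two_between_bruhat h (by exact_mod_cast hl)
    refine ⟨p, q, hpq, fun z => ?_⟩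
    rw [← hz]
    norm_cast
    simp

/-- The rank function of `Q`. -/
noncomputable def qRank (t : W × W × W) : ℤ :=
  cs.length t.1 + (-cs.length t.2.1 + cs.length t.2.2)

lemma gradedThin_qqle : GradedThin Set.univ (qqle cs) (qRank cs) :=
  (gradedThin_bruhatLE cs).prod ((gradedThin_bruhatLE cs).flip.prod (gradedThin_bruhatLE cs))

variable {cs}

lemma exists_bruhatLE_mul (x : W) {v v' : W} (h : bruhatLE cs v v') :
    ∃ y, bruhatLE cs y x ∧ bruhatLE cs (y * v) (x * v') := by
  obtain ⟨ω, hω, rfl⟩ := cs.exists_isReduced x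
  induction ω with
  | nil => exact ⟨1, bruhatLE_refl cs _, by simpa using h⟩
  | cons i ω ih =>
    obtain ⟨hω', hlt⟩ := length_wordProd_lt_of_isReduced_cons hω
    obtain ⟨y, h₁, h₂⟩ := ih hω'
    rw [cs.wordProd_cons, mul_assoc]
    rcases bruhatLE_simple_mul h₂ i with h₃ | h₃
    · exact ⟨cs.simple i * y, bruhatLE_simple_mul_of_lt h₁ hlt, by rwa [mul_assoc]⟩
    · exact ⟨y, bruhatLE_trans h₁ (bruhatLE_simple hlt), h₃.2⟩

/-- The left downward Demazure product `x ∘_l v = y v` satisfies `ℓ (y v) = ℓ v - ℓ y`. -/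
lemma exists_bruhatLE_mul_length (x v : W) :
    ∃ y, bruhatLE cs y x ∧ bruhatLE cs (y * v) (x * v) ∧
      cs.length (y * v) + cs.length y = cs.length v := by
  obtain ⟨ω, hω, rfl⟩ := cs.exists_isReduced x
  induction ω with
  | nil => exact ⟨1, bruhatLE_refl cs _, bruhatLE_refl cs _, by simp⟩
  | cons i ω ih =>
    obtain ⟨hω', hlt⟩ := length_wordProd_lt_of_isReduced_cons hω
    obtain ⟨y, h₁, h₂, h₃⟩ := ih hω'
    rw [cs.wordProd_cons, mul_assoc]
    rcases cs.length_simple_mul (y * v) i with h₄ | h₄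
    · exact ⟨y, bruhatLE_trans h₁ (bruhatLE_simple hlt),
        bruhatLE_simple_mul_right h₂ (by omega), h₃⟩
    · refine ⟨cs.simple i * y, bruhatLE_simple_mul_of_lt h₁ hlt, ?_, ?_⟩
      · rw [mul_assoc]
        exact bruhatLE_simple_mul_of_gt h₂ (by omega)
      · have h₅ := cs.length_le_length_mul_add_left (cs.simple i * y) v
        rw [mul_assoc] at h₅ ⊢
        have h₆ := cs.length_simple_mul y i
        omega

lemma Qmem.mono {a b : W × W × W} (ha : Qmem cs a) (h : qqle cs a b) : Qmem cs b := by
  obtain ⟨x, h₁, h₂⟩ := ha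
  obtain ⟨y, h₃, h₄⟩ := exists_bruhatLE_mul x h.2.1
  exact ⟨y, bruhatLE_trans h₃ (bruhatLE_trans h₁ h.1),
    bruhatLE_trans h₄ (bruhatLE_trans h₂ h.2.2)⟩

/-- Below every element of `Q` there is one of rank zero. -/
lemma Qmem.exists_length_eq {w v u : W} (h : Qmem cs (w, v, u)) :
    ∃ x, bruhatLE cs x w ∧ bruhatLE cs (x * v) u ∧
      cs.length (x * v) + cs.length x = cs.length v := by
  obtain ⟨x, h₁, h₂⟩ := h
  obtain ⟨y, h₃, h₄, h₅⟩ := exists_bruhatLE_mul_length (cs := cs) x v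
  exact ⟨y, bruhatLE_trans h₃ h₁, bruhatLE_trans h₄ h₂, h₅⟩

lemma Qmem_self (w v : W) : Qmem cs (w, v, w * v) :=
  ⟨w, bruhatLE_refl cs _, bruhatLE_refl cs _⟩

lemma Qmem.qRank_nonneg {t : W × W × W} (h : Qmem cs t) : 0 ≤ qRank cs t := by
  obtain ⟨w, v, u⟩ := t
  obtain ⟨x, h₁, h₂, h₃⟩ := h.exists_length_eq
  have h₄ := (gradedThin_bruhatLE cs).rk_le (Set.mem_univ _) (Set.mem_univ _) h₁
  have h₅ := (gradedThin_bruhatLE cs).rk_le (Set.mem_univ _) (Set.mem_univ _) h₂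
  simp only [qRank]
  omega

lemma Qmem.eq_mul_of_qRank_eq_zero {w v u : W} (h : Qmem cs (w, v, u))
    (hr : qRank cs (w, v, u) = 0) : u = w * v := by
  obtain ⟨x, h₁, h₂, h₃⟩ := h.exists_length_eq
  have h₄ := (gradedThin_bruhatLE cs).rk_le (Set.mem_univ _) (Set.mem_univ _) h₁
  have h₅ := (gradedThin_bruhatLE cs).rk_le (Set.mem_univ _) (Set.mem_univ _) h₂
  simp only [qRank] at hr
  obtain rfl := (bruhatLE_eq_or_length_lt h₁).resolve_right (by omega)
  exact ((bruhatLE_eq_or_length_lt h₂).resolve_right (by omega)).symm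

/-- A triple of rank one in `Q` has the form `(w, v, r w v)` for a reflection `r`. -/
lemma Qmem.exists_reflection {w v u : W} (h : Qmem cs (w, v, u))
    (hr : qRank cs (w, v, u) = 1) : ∃ r, cs.IsReflection r ∧ u = r * (w * v) := by
  obtain ⟨x, h₁, h₂, h₃⟩ := h.exists_length_eq
  simp only [qRank] at hr
  rcases bruhatLE_eq_or_length_lt h₁ with rfl | h₄
  · obtain ⟨r, hr', h₆⟩ := exists_reflection_of_bruhatLE h₂ (by omega)
    exact ⟨r, hr', by rw [h₆, ← mul_assoc, hr'.mul_self, one_mul]⟩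
  · have h₅ := (gradedThin_bruhatLE cs).rk_le (Set.mem_univ _) (Set.mem_univ _) h₂
    obtain ⟨r, hr', rfl⟩ := exists_reflection_of_bruhatLE h₁ (by omega)
    exact ⟨r, hr', by
      rw [← (bruhatLE_eq_or_length_lt h₂).resolve_right (by omega), mul_assoc]⟩

/-- The elements of rank zero below `(w, v, r w v)`, of rank one in `Q`. -/
lemma Qmem.below_iff {r w v : W} (hr : cs.IsReflection r)
    (hrk : qRank cs (w, v, r * (w * v)) = 1) (z : W × W × W) :
    (Qmem cs z ∧ qqle cs z (w, v, r * (w * v)) ∧ qRank cs z = 0) ↔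
      (z = (r * w, v, r * (w * v)) ∧ cs.length (r * w) < cs.length w) ∨
      (z = (w, w⁻¹ * (r * (w * v)), r * (w * v)) ∧
        ¬ cs.length (w⁻¹ * r * w * v) < cs.length v) ∨
      (z = (w, v, w * v) ∧ ¬ cs.length (r * (w * v)) < cs.length (w * v)) := by
  have hr' : cs.IsReflection (w⁻¹ * r * w) := by simpa using hr.conj w⁻¹
  have hv : w⁻¹ * (r * (w * v)) = w⁻¹ * r * w * v := by simp only [mul_assoc]
  have hle : ∀ {t y : W}, cs.IsReflection t → ¬ cs.length (t * y) < cs.length y →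
      bruhatLE cs y (t * y) ∧ cs.length y < cs.length (t * y) := by
    intro t y ht h
    have hlt : cs.length y < cs.length (t * y) :=
      (ht.length_mul_right_ne y).symm.lt_of_le (not_lt.1 h)
    have h' := bruhatLE_of_reflection (w := t * y) ht
      (by rwa [← mul_assoc, ht.mul_self, one_mul])
    rw [← mul_assoc, ht.mul_self, one_mul] at h'
    exact ⟨h', hlt⟩
  have hzero : ∀ z, Qmem cs z → qqle cs z (w, v, r * (w * v)) →
      z ≠ (w, v, r * (w * v)) → qRank cs z = 0 := by
    intro z hz hzt hne
    have h₁ := ((gradedThin_qqle cs).eq_or_rk_lt (Set.mem_univ _) (Set.mem_univ _)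
      hzt).resolve_left hne
    have h₂ := hz.qRank_nonneg
    omega
  constructor
  · obtain ⟨x, y, m⟩ := z
    rintro ⟨hz, ⟨h₁, h₂, h₃⟩, hzr⟩
    obtain rfl := hz.eq_mul_of_qRank_eq_zero hzr
    simp only at h₁ h₂ h₃
    simp only [qRank] at hzr hrk
    have h₄ := bruhatLE_eq_or_length_lt h₁
    have h₅ := bruhatLE_eq_or_length_lt h₂
    have h₆ := bruhatLE_eq_or_length_lt h₃
    rcases h₄ with rfl | h₄
    · rcases h₅ with rfl | h₅
      · right; right
        refine ⟨rfl, ?_⟩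
        omega
      · right; left
        have h₇ : x * y = r * (x * v) := h₆.resolve_right (by omega)
        have h₈ : y = x⁻¹ * (r * (x * v)) := by rw [← h₇, inv_mul_cancel_left]
        rw [← hv, ← h₇, inv_mul_cancel_left]
        exact ⟨rfl, by omega⟩
    · left
      obtain rfl : v = y := h₅.resolve_right (by
        rcases h₆ with h₆ | h₆
        · rw [h₆] at hzr
          omega
        · omega)
      have h₇ : x * v = r * (w * v) := h₆.resolve_right (by omega)
      rw [← mul_assoc] at h₇
      obtain rfl := mul_right_cancel h₇
      rw [mul_assoc]
      exact ⟨rfl, h₄⟩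
  · have key : ∀ z, Qmem cs z → qqle cs z (w, v, r * (w * v)) →
        z ≠ (w, v, r * (w * v)) →
        Qmem cs z ∧ qqle cs z (w, v, r * (w * v)) ∧ qRank cs z = 0 :=
      fun z h₁ h₂ h₃ => ⟨h₁, h₂, hzero z h₁ h₂ h₃⟩
    have hrefl := bruhatLE_refl cs
    rintro (⟨rfl, h⟩ | ⟨rfl, h⟩ | ⟨rfl, h⟩)
    · refine key _ ?_ ⟨bruhatLE_of_reflection hr h, hrefl _, hrefl _⟩ ?_
      · rw [← mul_assoc]
        exact Qmem_self _ _
      · intro heq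
        rw [(Prod.mk.inj heq).1] at h
        exact lt_irrefl _ h
    · obtain ⟨h₁, h₂⟩ := hle hr' h
      rw [hv]
      refine key _ ?_ ⟨hrefl _, h₁, hrefl _⟩ ?_
      · have := Qmem_self (cs := cs) w (w⁻¹ * r * w * v)
        rwa [← hv, mul_inv_cancel_left, hv] at this
      · intro heq
        rw [(Prod.mk.inj (Prod.mk.inj heq).2).1] at h₂
        exact lt_irrefl _ h₂
    · obtain ⟨h₁, h₂⟩ := hle hr h
      refine key _ (Qmem_self _ _) ⟨hrefl _, hrefl _, h₁⟩ ?_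
      intro heq
      rw [← (Prod.mk.inj (Prod.mk.inj heq).2).2] at h₂
      exact lt_irrefl _ h₂

/-- Each element of rank one in `Q` covers exactly two elements of `Q`. -/
lemma Qmem.exists_two_below {t : W × W × W} (ht : Qmem cs t) (hrk : qRank cs t = 1) :
    ∃ p q, p ≠ q ∧ ∀ z, (Qmem cs z ∧ qqle cs z t ∧ qRank cs z = 0) ↔ z = p ∨ z = q := by
  obtain ⟨w, v, u⟩ := t
  obtain ⟨r, hr, rfl⟩ := ht.exists_reflection hrk
  have hcocycle := length_mul_mul_lt_iff hr w v
  have hne := hr.length_mul_right_ne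
  simp only [Qmem.below_iff hr hrk]
  have hAV : (r * w, v, r * (w * v)) ≠ (w, w⁻¹ * (r * (w * v)), r * (w * v)) := fun h =>
    hne w (by rw [(Prod.mk.inj h).1])
  have hAU : (r * w, v, r * (w * v)) ≠ (w, v, w * v) := fun h =>
    hne w (by rw [(Prod.mk.inj h).1])
  have hVU : (w, w⁻¹ * (r * (w * v)), r * (w * v)) ≠ (w, v, w * v) := fun h =>
    hne (w * v) (by rw [(Prod.mk.inj (Prod.mk.inj h).2).2])
  by_cases hA : cs.length (r * w) < cs.length w <;>
    by_cases hV : cs.length (w⁻¹ * r * w * v) < cs.length v <;>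
    simp only [hA, hV, iff_self, not_true, not_false_iff, iff_true, iff_false]
      at hcocycle
  · exact ⟨_, _, hAU, fun z => by simp [hA, hV, hcocycle]⟩
  · exact ⟨_, _, hAV, fun z => by simp [hA, hV, hcocycle]⟩
  · obtain ⟨x, h₁, h₂, h₃⟩ := ht.exists_length_eq
    have := (Qmem.below_iff hr hrk (x, v, x * v)).1
      ⟨Qmem_self _ _, ⟨h₁, bruhatLE_refl cs _, h₂⟩, by simp only [qRank]; omega⟩
    simp [hA, hV, hcocycle] at this
  · exact ⟨_, _, hVU, fun z => by simp [hA, hV, hcocycle]⟩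

variable (cs) in
/-- The rank function of `Q̂`. -/
noncomputable def hatRank : Option (W × W × W) → ℤ
  | none => -1
  | some t => qRank cs t

variable (cs) in
lemma gradedThin_hle : GradedThin {q | hvalid cs q} (hle cs) (hatRank cs) where
  refl
    | none => trivial
    | some t => (gradedThin_qqle cs).refl t
  trans {a b c} hab hbc := by
    cases a <;> cases b <;> cases c <;> simp only [hle] at hab hbc ⊢
    exact (gradedThin_qqle cs).trans hab hbc
  eq_or_rk_lt {a b} ha hb hab := by
    cases a <;> cases b <;> simp only [hle] at hab
    · exact Or.inl rfl
    · have := Qmem.qRank_nonneg hb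
      right
      simp only [hatRank]
      omega
    · exact ((gradedThin_qqle cs).eq_or_rk_lt (Set.mem_univ _) (Set.mem_univ _) hab).imp
        (congrArg some) id
  exists_up {a b} ha hb hab hne := by
    cases a <;> cases b <;> simp only [hle] at hab
    · exact absurd rfl hne
    · rename_i t
      obtain ⟨w, v, u⟩ := t
      obtain ⟨x, h₁, h₂, h₃⟩ := Qmem.exists_length_eq hb
      refine ⟨some (x, v, x * v), Qmem_self _ _, trivial,
        ⟨h₁, bruhatLE_refl cs _, h₂⟩, ?_⟩
      simp only [hatRank, qRank]
      omega
    · obtain ⟨z, -, h₁, h₂, h₃⟩ := (gradedThin_qqle cs).exists_up (Set.mem_univ _)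
        (Set.mem_univ _) hab (fun h => hne (congrArg some h))
      exact ⟨some z, Qmem.mono ha h₁, h₁, h₂, h₃⟩
  exists_two_between {a b} ha hb hab hr := by
    cases a <;> cases b <;> simp only [hle] at hab
    · simp [hatRank] at hr
    · obtain ⟨p, q, hpq, hz⟩ := Qmem.exists_two_below hb (by simpa [hatRank] using hr)
      refine ⟨some p, some q, by simpa using hpq, ?_⟩
      rintro (_ | z)
      · simp [hatRank]
      · simpa [hle, hatRank, hvalid] using hz z
    · rename_i a b
      obtain ⟨p, q, hpq, hz⟩ := (gradedThin_qqle cs).exists_two_between (Set.mem_univ _)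
        (Set.mem_univ _) hab hr
      refine ⟨some p, some q, by simpa using hpq, ?_⟩
      rintro (_ | z)
      · simp [hle]
      · simp only [Option.some.injEq, ← hz, hle, hatRank]
        exact ⟨fun h => ⟨Set.mem_univ _, h.2⟩, fun h => ⟨Qmem.mono ha h.2.1, h.2⟩⟩

variable (cs) in
lemma hcov_iff {p q : Option (W × W × W)} :
    hcov cs p q ↔ hvalid cs p ∧ hvalid cs q ∧ hle cs p q ∧ hatRank cs q = hatRank cs p + 1 :=
  (gradedThin_hle cs).cov_iff

lemma length_of_isChainFrom_hcov {c : List (Option (W × W × W))} {p q : Option (W × W × W)}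
    (h : IsChainFrom (hcov cs) c p q) : (c.length : ℤ) = hatRank cs q - hatRank cs p + 1 :=
  h.length_eq (rk := hatRank cs) fun h => ((hcov_iff cs).1 h).2.2.2

end AugmentedPoset

/-- The augmented poset `Q̂` is pure and thin: for any `q₁ ≤ q₂`
in `Q̂`, a maximal chain from `q₁` to `q₂` exists and all such chains have the
same length, and every interval of length `2` in `Q̂` (i.e. one carrying a maximal
chain with `3` elements) contains exactly `4` elements. Moreover, for every
`(w, v, u) ∈ Q`, every maximal chain in `Q̂` from `0̂` to `(w, v, u)` has length
`ℓ(w) + ℓ(u) - ℓ(v) + 1` (i.e. it has `ℓ(w) + ℓ(u) - ℓ(v) + 2` elements). -/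
theorem Qhat_pure_thin :
    (∀ q₁ q₂ : Option (W × W × W), hvalid cs q₁ → hvalid cs q₂ → hle cs q₁ q₂ →
      (∃ c : List (Option (W × W × W)), IsChainFrom (hcov cs) c q₁ q₂) ∧
      (∀ c c' : List (Option (W × W × W)), IsChainFrom (hcov cs) c q₁ q₂ →
        IsChainFrom (hcov cs) c' q₁ q₂ → c.length = c'.length)) ∧
    (∀ q₁ q₂ : Option (W × W × W), hvalid cs q₁ → hvalid cs q₂ → hle cs q₁ q₂ →
      ∀ c : List (Option (W × W × W)), IsChainFrom (hcov cs) c q₁ q₂ → c.length = 3 →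
        {z : Option (W × W × W) | hvalid cs z ∧ hle cs q₁ z ∧ hle cs z q₂}.ncard = 4) ∧
    (∀ w v u : W, Qmem cs (w, v, u) →
      ∀ c : List (Option (W × W × W)), IsChainFrom (hcov cs) c none (some (w, v, u)) →
        (c.length : ℤ) = (cs.length w : ℤ) + (cs.length u : ℤ) - (cs.length v : ℤ) + 2) := by
  refine ⟨fun q₁ q₂ h₁ h₂ h => ⟨?_, ?_⟩, ?_, ?_⟩
  · exact (gradedThin_hle cs).exists_isChainFrom
      (fun ha hb hab hr => (hcov_iff cs).2 ⟨ha, hb, hab, hr⟩) h₁ h₂ h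
  · intro c c' hc hc'
    have e := length_of_isChainFrom_hcov hc
    have e' := length_of_isChainFrom_hcov hc'
    omega
  · intro q₁ q₂ h₁ h₂ h c hc hlen
    have e := length_of_isChainFrom_hcov hc
    exact (gradedThin_hle cs).ncard_eq_four h₁ h₂ h (by omega)
  · intro w v u _ c hc
    have e := length_of_isChainFrom_hcov hc
    simp only [hatRank, qRank] at e
    omega

end TwistedTP
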